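/- arXiv:1207.5440 — 2 statements merged into one kernel-verified Lean document; each statement's English description precedes it below -/
import Mathlib

section
/- Let U ⊆ ℝ² be a contractible open set and let a, b : U → ℝ be smooth functions. Then the pair of equations X²b = (XY + Z)a and Y²a = (YX − Z)b holds on U if and only if there exist a smooth function f : U → ℝ and a constant C ∈ ℝ such that Xf = a and Yf = C + b on U. -/
/-- First Grushin operator `X = ∂/∂x` on `ℝ²` with coordinates `(x, y)`. -/
noncomputable def opX (f : (Fin 2 → ℝ) → ℝ) : (Fin 2 → ℝ) → ℝ :=
  fun p => fderiv ℝ f p ![1, 0]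

/-- First Grushin operator `Y = x ∂/∂y` on `ℝ²`. -/
noncomputable def opY (f : (Fin 2 → ℝ) → ℝ) : (Fin 2 → ℝ) → ℝ :=
  fun p => fderiv ℝ f p ![0, p 0]

/-- First Grushin operator `Z = [X, Y] = ∂/∂y` on `ℝ²`. -/
noncomputable def opZ (f : (Fin 2 → ℝ) → ℝ) : (Fin 2 → ℝ) → ℝ :=
  fun p => fderiv ℝ f p ![0, 1]

open Set Topology Bundle

/-- A family of local functions on a simply connected space whose pairwise differences are locally
constant can be glued, up to locally constant functions, to a global function. -/
theorem exists_eventually_sub_eq_of_simplyConnectedSpace {B F : Type*} [TopologicalSpace B]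
    [SimplyConnectedSpace B] [LocallyPathConnectedSpace B] [AddCommGroup F]
    (V : B → Set B) (hV : ∀ i, IsOpen (V i)) (hmem : ∀ i, i ∈ V i) (g : B → B → F)
    (hg : ∀ i j, ∀ x ∈ V i ∩ V j, ∀ᶠ y in 𝓝 x, g i y - g j y = g i x - g j x) :
    ∃ f : B → F, ∀ i, ∀ x ∈ V i, ∀ᶠ y in 𝓝 x, f y - g i y = f x - g i x := by
  let : TopologicalSpace F := ⊥
  have : DiscreteTopology F := ⟨rfl⟩
  let Z : FiberBundleCore B B F :=
    { baseSet := V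
      isOpen_baseSet := hV
      indexAt := id
      mem_baseSet_at := hmem
      coordChange := fun i j x v => v + (g i x - g j x)
      coordChange_self := by simp
      continuousOn_coordChange := by
        rintro i j ⟨x, v⟩ ⟨hx, -⟩
        refine ContinuousAt.continuousWithinAt ?_
        have h : ContinuousAt (fun y => g i y - g j y) x :=
          continuousAt_const.congr ((hg i j x hx).mono fun y hy => hy.symm)
        exact continuousAt_snd.add (h.comp (f := Prod.fst) (x := (x, v)) continuousAt_fst)
      coordChange_comp := by intros; abel }
  have hcov : IsCoveringMap (π F Z.Fiber) := FiberBundle.isCoveringMap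
  obtain ⟨b₀⟩ : Nonempty B := inferInstance
  obtain ⟨s, ⟨-, hs⟩, -⟩ :=
    hcov.existsUnique_continuousMap_lifts (ContinuousMap.id B) b₀ ⟨b₀, (0 : F)⟩ rfl
  have hsx : ∀ x, (s x).proj = x := fun x => congrFun hs x
  refine ⟨fun x => Z.coordChange (s x).proj x x (s x).2 + g x x, fun i x hx => ?_⟩
  have hc : ContinuousAt (fun y => (Z.localTriv i (s y)).2) x := by
    have h : ContinuousAt (Z.localTriv i) (s x) :=
      (Z.localTriv i).continuousAt ((Z.localTriv i).mem_source.2 (by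
        change (s x).proj ∈ V i
        rw [hsx]
        exact hx))
    exact (h.comp (f := s) s.continuous.continuousAt).snd
  have key : ∀ y, (Z.localTriv i (s y)).2
      = Z.coordChange (s y).proj y y (s y).2 + g y y - g i y := by
    intro y
    let v : F := (s y).2
    change v + (g (s y).proj (s y).proj - g i (s y).proj)
      = v + (g (s y).proj y - g y y) + g y y - g i y
    rw [hsx]
    abel
  have h := hc.eventually (IsOpen.mem_nhds (isOpen_discrete {(Z.localTriv i (s x)).2}) rfl)
  filter_upwards [h] with y hy
  rw [← key, ← key]
  exact hy

/-- **Poincaré lemma** for 1-forms on simply connected open sets. -/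
theorem exists_forall_hasFDerivAt_of_simplyConnectedSpace {E F : Type*}
    [NormedAddCommGroup E] [NormedSpace ℝ E] [NormedAddCommGroup F] [NormedSpace ℝ F]
    [CompleteSpace F] {U : Set E} (hU : IsOpen U) [SimplyConnectedSpace U]
    {ω : E → E →L[ℝ] F} (hω : DifferentiableOn ℝ ω U)
    (hdω : ∀ p ∈ U, ∀ u v, fderiv ℝ ω p u v = fderiv ℝ ω p v u) :
    ∃ f : E → F, ∀ p ∈ U, HasFDerivAt f (ω p) p := by
  have : LocallyPathConnectedSpace U := hU.locallyPathConnectedSpace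
  have hloc : ∀ i : U, ∃ r > 0, ∃ g : E → F, Metric.ball (i : E) r ⊆ U ∧
      ∀ p ∈ Metric.ball (i : E) r, HasFDerivAt g (ω p) p := by
    intro i
    obtain ⟨r, hr, hball⟩ := Metric.isOpen_iff.1 hU i i.2
    obtain ⟨g, hg⟩ := (convex_ball (i : E) r).exists_forall_hasFDerivAt_of_fderiv_symmetric
      Metric.isOpen_ball (hω.mono hball) fun p hp => hdω p (hball hp)
    exact ⟨r, hr, g, hball, hg⟩
  choose r hr g hball hg using hloc
  obtain ⟨f, hf⟩ := exists_eventually_sub_eq_of_simplyConnectedSpace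
    (fun i : U => Subtype.val ⁻¹' Metric.ball (i : E) (r i))
    (fun i => Metric.isOpen_ball.preimage continuous_subtype_val)
    (fun i => Metric.mem_ball_self (hr i)) (fun i x => g i x) (by
      rintro i j x ⟨hi, hj⟩
      obtain ⟨ε, hε, hsub⟩ := Metric.isOpen_iff.1
        ((Metric.isOpen_ball (x := (i : E)) (ε := r i)).inter
          (Metric.isOpen_ball (x := (j : E)) (ε := r j))) x ⟨hi, hj⟩
      have hd : ∀ y ∈ Metric.ball (x : E) ε, HasFDerivAt (fun y => g i y - g j y) (0 : E →L[ℝ] F) y :=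
        fun y hy => by simpa using (hg i y (hsub hy).1).fun_sub (hg j y (hsub hy).2)
      filter_upwards [continuous_subtype_val.continuousAt.eventually
        (Metric.ball_mem_nhds (x : E) hε)] with y hy
      exact (convex_ball (x : E) ε).is_const_of_fderivWithin_eq_zero (𝕜 := ℝ)
        (fun z hz => (hd z hz).differentiableAt.differentiableWithinAt)
        (fun z hz => by
          rw [fderivWithin_of_isOpen Metric.isOpen_ball hz, (hd z hz).fderiv])
        hy (Metric.mem_ball_self hε))
  classical
  refine ⟨fun p => if h : p ∈ U then f ⟨p, h⟩ else 0, fun p hp => ?_⟩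
  have h1 := hf ⟨p, hp⟩ ⟨p, hp⟩ (Metric.mem_ball_self (hr _))
  have h2 := (hg ⟨p, hp⟩ p (Metric.mem_ball_self (hr _))).add_const (f ⟨p, hp⟩ - g ⟨p, hp⟩ p)
  refine h2.congr_of_eventuallyEq ?_
  rw [nhds_subtype_eq_comap, Filter.eventually_comap] at h1
  filter_upwards [h1, hU.mem_nhds hp] with y hy hyU
  have := hy ⟨y, hyU⟩ rfl
  simp only [hyU, dif_pos]
  rw [← this]
  abel

section Operators

variable {U : Set (Fin 2 → ℝ)} {f g : (Fin 2 → ℝ) → ℝ} {p : Fin 2 → ℝ}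

theorem opY_eq_mul_opZ (f : (Fin 2 → ℝ) → ℝ) : opY f = fun p => p 0 * opZ f p := by
  funext p
  have h : (![0, p 0] : Fin 2 → ℝ) = p 0 • ![0, 1] := by simp
  simp only [opY, opZ, h, map_smul, smul_eq_mul]

theorem fderiv_apply_eq_opX_opZ (f : (Fin 2 → ℝ) → ℝ) (p u : Fin 2 → ℝ) :
    fderiv ℝ f p u = u 0 * opX f p + u 1 * opZ f p := by
  have h : u = u 0 • ![1, 0] + u 1 • ![0, 1] := by
    ext i; fin_cases i <;> simp
  conv_lhs => rw [h]
  simp only [opX, opZ, map_add, map_smul, smul_eq_mul]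

theorem contDiffOn_fderiv_apply (hU : IsOpen U) (hf : ContDiffOn ℝ (⊤ : ℕ∞) f U)
    (v : Fin 2 → ℝ) : ContDiffOn ℝ (⊤ : ℕ∞) (fun p => fderiv ℝ f p v) U :=
  (hf.fderiv_of_isOpen hU (by simp)).clm_apply contDiffOn_const

theorem contDiffOn_opX (hU : IsOpen U) (hf : ContDiffOn ℝ (⊤ : ℕ∞) f U) :
    ContDiffOn ℝ (⊤ : ℕ∞) (opX f) U :=
  contDiffOn_fderiv_apply hU hf _

theorem contDiffOn_opZ (hU : IsOpen U) (hf : ContDiffOn ℝ (⊤ : ℕ∞) f U) :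
    ContDiffOn ℝ (⊤ : ℕ∞) (opZ f) U :=
  contDiffOn_fderiv_apply hU hf _

theorem contDiffOn_opY (hU : IsOpen U) (hf : ContDiffOn ℝ (⊤ : ℕ∞) f U) :
    ContDiffOn ℝ (⊤ : ℕ∞) (opY f) U := by
  rw [opY_eq_mul_opZ]
  exact (contDiff_apply ℝ ℝ (0 : Fin 2)).contDiffOn.mul (contDiffOn_opZ hU hf)

theorem ContDiffOn.differentiableAt_of_isOpen (hf : ContDiffOn ℝ (⊤ : ℕ∞) f U) (hU : IsOpen U)
    (hp : p ∈ U) : DifferentiableAt ℝ f p :=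
  (hf.differentiableOn (by simp)).differentiableAt (hU.mem_nhds hp)

theorem fderiv_eq_of_eqOn (hU : IsOpen U) (h : EqOn f g U) (hp : p ∈ U) :
    fderiv ℝ f p = fderiv ℝ g p :=
  (h.eventuallyEq_of_mem (hU.mem_nhds hp)).fderiv_eq

theorem opX_opZ_comm (hU : IsOpen U) (hf : ContDiffOn ℝ (⊤ : ℕ∞) f U) (hp : p ∈ U) :
    opX (opZ f) p = opZ (opX f) p := by
  have hd : DifferentiableAt ℝ (fderiv ℝ f) p :=
    ((hf.fderiv_of_isOpen (m := (⊤ : ℕ∞)) hU (by simp)).differentiableOn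
      (by simp)).differentiableAt (hU.mem_nhds hp)
  have hsymm : IsSymmSndFDerivAt ℝ f p :=
    (hf.contDiffAt (hU.mem_nhds hp)).isSymmSndFDerivAt
      (by simp only [minSmoothness_of_isRCLikeNormedField]; exact WithTop.coe_le_coe.2 le_top)
  have key : ∀ u v : Fin 2 → ℝ,
      fderiv ℝ (fun q => fderiv ℝ f q u) p v = fderiv ℝ (fderiv ℝ f) p v u := fun u v => by
    rw [fderiv_clm_apply hd (differentiableAt_const u)]
    simp
  change fderiv ℝ (fun q => fderiv ℝ f q _) p _ = fderiv ℝ (fun q => fderiv ℝ f q _) p _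
  rw [key, key]
  exact hsymm _ _

theorem fderiv_coord_mul (hf : DifferentiableAt ℝ f p) (u : Fin 2 → ℝ) :
    fderiv ℝ (fun q => q 0 * f q) p u = u 0 * f p + p 0 * fderiv ℝ f p u := by
  have h0 : HasFDerivAt (fun q : Fin 2 → ℝ => q 0)
      (ContinuousLinearMap.proj (R := ℝ) (φ := fun _ : Fin 2 => ℝ) 0) p := hasFDerivAt_apply 0 p
  rw [(h0.fun_mul hf.hasFDerivAt).fderiv]
  simp
  ring

theorem opX_coord_mul (hf : DifferentiableAt ℝ f p) :
    opX (fun q => q 0 * f q) p = f p + p 0 * opX f p := by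
  simp [opX, fderiv_coord_mul hf]

theorem opZ_coord_mul (hf : DifferentiableAt ℝ f p) :
    opZ (fun q => q 0 * f q) p = p 0 * opZ f p := by
  simp [opZ, fderiv_coord_mul hf]

end Operators

/-- A closed form `a dx + w dy` on a simply connected open subset of the plane is exact. -/
theorem exists_opX_eq_opZ_eq {U : Set (Fin 2 → ℝ)} (hU : IsOpen U) [SimplyConnectedSpace U]
    {a w : (Fin 2 → ℝ) → ℝ} (ha : ContDiffOn ℝ (⊤ : ℕ∞) a U) (hw : ContDiffOn ℝ (⊤ : ℕ∞) w U)
    (h : ∀ p ∈ U, opZ a p = opX w p) :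
    ∃ f : (Fin 2 → ℝ) → ℝ, ContDiffOn ℝ (⊤ : ℕ∞) f U ∧
      ∀ p ∈ U, opX f p = a p ∧ opZ f p = w p := by
  let pr (i : Fin 2) := ContinuousLinearMap.proj (R := ℝ) (φ := fun _ : Fin 2 => ℝ) i
  let ω (p : Fin 2 → ℝ) : (Fin 2 → ℝ) →L[ℝ] ℝ := a p • pr 0 + w p • pr 1
  have hω : ContDiffOn ℝ (⊤ : ℕ∞) ω U :=
    (ha.smul contDiffOn_const).add (hw.smul contDiffOn_const)
  obtain ⟨f, hf⟩ := exists_forall_hasFDerivAt_of_simplyConnectedSpace hU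
    (hω.differentiableOn (by simp)) (fun p hp u v => by
      have h1 := ((ha.differentiableAt_of_isOpen hU hp).hasFDerivAt.smul_const (pr 0)).add
        ((hw.differentiableAt_of_isOpen hU hp).hasFDerivAt.smul_const (pr 1))
      have h2 : fderiv ℝ ω p = _ := h1.fderiv
      rw [h2]
      simp [pr, fderiv_apply_eq_opX_opZ, h p hp]
      ring)
  refine ⟨f, ?_, fun p hp => ?_⟩
  · rw [contDiffOn_infty_iff_fderiv_of_isOpen hU]
    exact ⟨fun p hp => (hf p hp).differentiableAt.differentiableWithinAt,
      hω.congr fun p hp => (hf p hp).fderiv⟩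
  · simp [opX, opZ, (hf p hp).fderiv, ω, pr]

theorem first_grushin_integrability
    (U : Set (Fin 2 → ℝ)) (hU : IsOpen U) (hUc : ContractibleSpace U)
    (a b : (Fin 2 → ℝ) → ℝ)
    (ha : ContDiffOn ℝ (⊤ : ℕ∞) a U) (hb : ContDiffOn ℝ (⊤ : ℕ∞) b U) :
    (∀ p ∈ U, opX (opX b) p = opX (opY a) p + opZ a p ∧
              opY (opY a) p = opY (opX b) p - opZ b p) ↔
    (∃ f : (Fin 2 → ℝ) → ℝ, ∃ C : ℝ, ContDiffOn ℝ (⊤ : ℕ∞) f U ∧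
      ∀ p ∈ U, opX f p = a p ∧ opY f p = C + b p) := by
  set w : (Fin 2 → ℝ) → ℝ := fun p => opX b p - opY a p with hw_def
  have hXb := contDiffOn_opX hU hb
  have hYa := contDiffOn_opY hU ha
  have hw : ContDiffOn ℝ (⊤ : ℕ∞) w U := hXb.sub hYa
  have hfw : ∀ p ∈ U, ∀ u, fderiv ℝ w p u = fderiv ℝ (opX b) p u - fderiv ℝ (opY a) p u :=
    fun p hp u => by
      rw [hw_def, fderiv_fun_sub (hXb.differentiableAt_of_isOpen hU hp)
        (hYa.differentiableAt_of_isOpen hU hp)]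
      rfl
  have hXw : ∀ p ∈ U, opX w p = opX (opX b) p - opX (opY a) p := fun p hp => hfw p hp _
  have hYw : ∀ p ∈ U, opY w p = opY (opX b) p - opY (opY a) p := fun p hp => hfw p hp _
  have hsystem : (∀ p ∈ U, opX (opX b) p = opX (opY a) p + opZ a p ∧
      opY (opY a) p = opY (opX b) p - opZ b p) ↔
      ∀ p ∈ U, opX w p = opZ a p ∧ p 0 * opZ w p = opZ b p := by
    refine forall₂_congr fun p hp => ?_
    have hY : p 0 * opZ w p = opY w p := (congrFun (opY_eq_mul_opZ w) p).symm
    rw [hY, hXw p hp, hYw p hp]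
    constructor <;> rintro ⟨h1, h2⟩ <;> constructor <;> linarith
  rw [hsystem]
  constructor
  · intro h
    obtain ⟨f, hf, hfaw⟩ := exists_opX_eq_opZ_eq hU ha hw fun p hp => (h p hp).1.symm
    have hpre : IsPreconnected U := isPreconnected_iff_preconnectedSpace.2 inferInstance
    have hconst : ∃ C, ∀ p ∈ U, p 0 * w p - b p = C := by
      refine hU.exists_is_const_of_fderiv_eq_zero (𝕜 := ℝ) hpre
        (f := fun p => p 0 * w p - b p) (fun p hp => ?_) fun p hp => ?_
      · exact (((differentiableAt_apply 0 p).mul (hw.differentiableAt_of_isOpen hU hp)).sub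
          (hb.differentiableAt_of_isOpen hU hp)).differentiableWithinAt
      · have hwp := hw.differentiableAt_of_isOpen hU hp
        ext1 u
        rw [fderiv_fun_sub ((differentiableAt_apply 0 p).fun_mul hwp)
          (hb.differentiableAt_of_isOpen hU hp)]
        have hYa' := congrFun (opY_eq_mul_opZ a) p
        have hwp' : w p = opX b p - opY a p := rfl
        simp only [sub_apply, fderiv_coord_mul hwp, fderiv_apply_eq_opX_opZ, Pi.zero_apply,
          zero_apply, (h p hp).1]
        linear_combination u 0 * hwp' + u 1 * (h p hp).2 - u 0 * hYa'
    obtain ⟨C, hC⟩ := hconst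
    refine ⟨f, C, hf, fun p hp => ⟨(hfaw p hp).1, ?_⟩⟩
    rw [opY_eq_mul_opZ]
    simp only [(hfaw p hp).2, ← hC p hp]
    ring
  · rintro ⟨f, C, hf, hfab⟩
    have hZf := contDiffOn_opZ hU hf
    have hdb : ∀ p ∈ U, fderiv ℝ b p = fderiv ℝ (fun q => q 0 * opZ f q) p := fun p hp => by
      have hb' : EqOn b (fun q => q 0 * opZ f q - C) U := fun q hq => by
        have h1 := (hfab q hq).2
        rw [opY_eq_mul_opZ] at h1
        simp only at h1 ⊢
        linarith
      rw [fderiv_eq_of_eqOn hU hb' hp, fderiv_sub_const]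
    have hda : ∀ p ∈ U, fderiv ℝ a p = fderiv ℝ (opX f) p := fun p hp =>
      fderiv_eq_of_eqOn hU (fun q hq => (hfab q hq).1.symm) hp
    have hwf : EqOn w (opZ f) U := fun p hp => by
      have hX : opX b p = opX (fun q => q 0 * opZ f q) p := by
        simp only [opX, hdb p hp]
      have hZ : opZ a p = opZ (opX f) p := by simp only [opZ, hda p hp]
      simp only [hw_def, opY_eq_mul_opZ, hX, hZ,
        opX_coord_mul (hZf.differentiableAt_of_isOpen hU hp), opX_opZ_comm hU hf hp]
      ring
    intro p hp
    have hdw := fderiv_eq_of_eqOn hU hwf hp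
    have hXw' : opX w p = opX (opZ f) p := by simp only [opX, hdw]
    have hZw' : opZ w p = opZ (opZ f) p := by
      change fderiv ℝ w p _ = fderiv ℝ (opZ f) p _
      rw [hdw]
    have hZa : opZ a p = opZ (opX f) p := by simp only [opZ, hda p hp]
    have hZb : opZ b p = opZ (fun q => q 0 * opZ f q) p := by
      change fderiv ℝ b p _ = fderiv ℝ _ p _
      rw [hdb p hp]
    rw [hXw', hZw', hZa, hZb, opX_opZ_comm hU hf hp,
      opZ_coord_mul (hZf.differentiableAt_of_isOpen hU hp)]
    exact ⟨rfl, rfl⟩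
end

section
/- Let U ⊆ ℝ² be a contractible open set. Then the first Grushin complex is exact at its final term: for every smooth function ρ : U → ℝ there exist smooth functions c, d : U → ℝ such that Xd + Yc = ρ on U. -/
open Set Topology MeasureTheory
open scoped Manifold

universe u

theorem exists_continuous_ball_subset {E : Type*} [PseudoMetricSpace E] {U : Set E}
    (hU : IsOpen U) :
    ∃ δ : E → ℝ, Continuous δ ∧ ∀ x ∈ U, 0 < δ x ∧ Metric.ball x (δ x) ⊆ U := by
  rcases Uᶜ.eq_empty_or_nonempty with h | h
  · refine ⟨fun _ ↦ 1, continuous_const, fun x _ ↦ ⟨one_pos, ?_⟩⟩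
    rw [compl_empty_iff.mp h]
    exact subset_univ _
  · refine ⟨fun x ↦ Metric.infDist x Uᶜ, Metric.continuous_infDist_pt _, fun x hx ↦
      ⟨?_, Metric.ball_infDist_compl_subset⟩⟩
    exact (hU.isClosed_compl.notMem_iff_infDist_pos h).mp (not_not.mpr hx)

/-- A contractible open subset of a finite-dimensional space is smoothly contractible. -/
theorem exists_contDiffOn_contraction {E : Type*} [NormedAddCommGroup E] [NormedSpace ℝ E]
    [FiniteDimensional ℝ E] {U : Set E} (hU : IsOpen U) [ContractibleSpace U] :
    ∃ (x₀ : E) (H : E × ℝ → E), ContDiffOn ℝ (⊤ : ℕ∞) H (U ×ˢ univ) ∧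
      MapsTo H (U ×ˢ univ) U ∧ (∀ x ∈ U, H (x, 0) = x) ∧ ∀ x ∈ U, H (x, 1) = x₀ := by
  obtain ⟨x₀, ⟨C⟩⟩ := id_nullhomotopic U
  obtain ⟨δ, hδ, hδU⟩ := exists_continuous_ball_subset hU
  let V : TopologicalSpace.Opens (E × ℝ) := ⟨U ×ˢ univ, hU.prod isOpen_univ⟩
  let f : V → E := fun q ↦
    C (projIcc (0 : ℝ) 1 zero_le_one (3 * q.1.2 - 1), ⟨q.1.1, q.2.1⟩)
  have hf : Continuous f := by
    refine continuous_subtype_val.comp (C.continuous.comp (Continuous.prodMk ?_ ?_))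
    · exact continuous_projIcc.comp (by fun_prop)
    · exact Continuous.subtype_mk (by fun_prop) _
  have hfU : ∀ q, f q ∈ U := fun q ↦ Subtype.coe_prop _
  have hf0 : ∀ q : V, q.1.2 ≤ 1 / 3 → f q = q.1.1 := by
    intro q hq
    simp only [f]
    rw [projIcc_of_le_left _ (by linarith)]
    exact congrArg Subtype.val (C.apply_zero _)
  have hf1 : ∀ q : V, 2 / 3 ≤ q.1.2 → f q = x₀ := by
    intro q hq
    simp only [f]
    rw [projIcc_of_right_le _ (by linarith)]
    exact congrArg Subtype.val (C.apply_one _)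
  have ht : Continuous fun q : V ↦ q.1.2 := by fun_prop
  let S : Set V := {q | q.1.2 ≤ 0} ∪ {q | 1 ≤ q.1.2}
  let W : Set V := {q | q.1.2 < 1 / 3} ∪ {q | 2 / 3 < q.1.2}
  have hS : IsClosed S := (isClosed_le ht continuous_const).union (isClosed_le continuous_const ht)
  have hW : IsOpen W := (isOpen_lt ht continuous_const).union (isOpen_lt continuous_const ht)
  have hSW : S ⊆ W := by
    rintro q (hq | hq)
    · exact Or.inl (lt_of_le_of_lt (hq) (by norm_num : (0 : ℝ) < 1 / 3))
    · exact Or.inr (lt_of_lt_of_le (by norm_num : (2 / 3 : ℝ) < 1) hq)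
  have hfW : ContMDiffOn 𝓘(ℝ, E × ℝ) 𝓘(ℝ, E) (⊤ : ℕ∞) f W := by
    rintro q (hq | hq)
    · have h : ContMDiffAt 𝓘(ℝ, E × ℝ) 𝓘(ℝ, E) (⊤ : ℕ∞) (fun q : V ↦ (q : E × ℝ).1) q :=
        contMDiffAt_subtype_iff.mpr contDiffAt_fst.contMDiffAt
      refine (h.congr_of_eventuallyEq ?_).contMDiffWithinAt
      filter_upwards [(isOpen_lt ht continuous_const).mem_nhds hq] with r hr
      exact hf0 r (le_of_lt hr)
    · have h : ContMDiffAt 𝓘(ℝ, E × ℝ) 𝓘(ℝ, E) (⊤ : ℕ∞) (fun _ : V ↦ (x₀ : E)) q :=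
        contMDiffAt_const
      refine (h.congr_of_eventuallyEq ?_).contMDiffWithinAt
      filter_upwards [(isOpen_lt continuous_const ht).mem_nhds hq] with r hr
      exact hf1 r (le_of_lt hr)
  have : SigmaCompactSpace V := by
    have : LocallyCompactSpace V := V.2.locallyCompactSpace
    infer_instance
  obtain ⟨g, hgf, hgS, -⟩ := hf.exists_contMDiff_approx_and_eqOn 𝓘(ℝ, E × ℝ) ⊤
    (hδ.comp hf) (fun q ↦ (hδU _ (hfU q)).1) hS (hW.mem_nhdsSet.mpr hSW) hfW
  classical
  let H : E × ℝ → E := fun q ↦ if h : q ∈ V then g ⟨q, h⟩ else 0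
  have hH : ∀ q : V, H q = g q := fun q ↦ dif_pos q.2
  refine ⟨x₀, H, fun q hq ↦ ?_, fun q hq ↦ ?_, fun x hx ↦ ?_, fun x hx ↦ ?_⟩
  · have h : ContMDiffAt 𝓘(ℝ, E × ℝ) 𝓘(ℝ, E) (⊤ : ℕ∞) (fun q : V ↦ H q) ⟨q, hq⟩ := by
      simp only [hH]
      exact g.contMDiff _
    exact (contMDiffAt_subtype_iff.mp h).contDiffAt.contDiffWithinAt
  · have := hH ⟨q, hq⟩
    simp only at this
    rw [this]
    exact (hδU _ (hfU _)).2 (hgf _)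
  · have hq : (x, (0 : ℝ)) ∈ V := ⟨hx, mem_univ _⟩
    refine (hH ⟨_, hq⟩).trans ((hgS (Or.inl (le_refl (0 : ℝ)))).trans (hf0 _ ?_))
    norm_num
  · have hq : (x, (1 : ℝ)) ∈ V := ⟨hx, mem_univ _⟩
    refine (hH ⟨_, hq⟩).trans ((hgS (Or.inr (le_refl (1 : ℝ)))).trans (hf1 _ ?_))
    norm_num

theorem hasFDerivAt_intervalIntegral_of_contDiffOn {E F : Type u} [NormedAddCommGroup E]
    [NormedSpace ℝ E] [FiniteDimensional ℝ E] [NormedAddCommGroup F] [NormedSpace ℝ F]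
    {U : Set E} (hU : IsOpen U) {f : E × ℝ → F}
    (hf : ContDiffOn ℝ 1 f (U ×ˢ univ)) {x : E} (hx : x ∈ U) (a b : ℝ) :
    HasFDerivAt (fun x ↦ ∫ t in a..b, f (x, t))
      (∫ t in a..b, (fderiv ℝ f (x, t)).comp (.inl ℝ E ℝ)) x := by
  have hV : IsOpen (U ×ˢ (univ : Set ℝ)) := hU.prod isOpen_univ
  have : ProperSpace E := FiniteDimensional.proper_real E
  obtain ⟨r, hr, hrU⟩ := Metric.nhds_basis_closedBall.mem_iff.mp (hU.mem_nhds hx)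
  have hf' : ContinuousOn (fun q ↦ (fderiv ℝ f q).comp (.inl ℝ E ℝ)) (U ×ˢ univ) :=
    (hf.continuousOn_fderiv_of_isOpen hV le_rfl).clm_comp continuousOn_const
  have hslice {G : Type u} [TopologicalSpace G] {h : E × ℝ → G}
      (hh : ContinuousOn h (U ×ˢ univ)) {y : E} (hy : y ∈ U) : Continuous fun t ↦ h (y, t) :=
    hh.comp_continuous (by fun_prop) fun t ↦ ⟨hy, mem_univ _⟩
  obtain ⟨M, hM⟩ := ((isCompact_closedBall x r).prod
    (isCompact_uIcc (a := a) (b := b))).exists_bound_of_continuousOn (hf'.mono (prod_mono hrU (subset_univ _)))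
  refine intervalIntegral.hasFDerivAt_integral_of_dominated_of_fderiv_le
    (F := fun y t ↦ f (y, t)) (F' := fun y t ↦ (fderiv ℝ f (y, t)).comp (.inl ℝ E ℝ))
    (bound := fun _ ↦ M)
    (Metric.closedBall_mem_nhds x hr) ?_ ?_ ?_ ?_ ?_ ?_
  · filter_upwards [hU.mem_nhds hx] with y hy
    exact (hslice hf.continuousOn hy).aestronglyMeasurable
  · exact (hslice hf.continuousOn hx).intervalIntegrable _ _
  · exact (hslice hf' hx).aestronglyMeasurable
  · exact .of_forall fun t ht y hy ↦ hM (y, t) (mk_mem_prod hy (uIoc_subset_uIcc ht))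
  · exact intervalIntegrable_const
  · refine .of_forall fun t ht y hy ↦ ?_
    have h := ((hf.differentiableOn one_ne_zero).differentiableAt
      (hV.mem_nhds (mk_mem_prod (hrU hy) (mem_univ t)))).hasFDerivAt
    exact h.comp y (hasFDerivAt_prodMk_left y t)

/-- Integrals depending smoothly on a parameter in an open set are smooth. -/
theorem contDiffOn_intervalIntegral {E F : Type u} [NormedAddCommGroup E]
    [NormedSpace ℝ E] [FiniteDimensional ℝ E] [NormedAddCommGroup F] [NormedSpace ℝ F]
    {U : Set E} (hU : IsOpen U) {f : E × ℝ → F}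
    (hf : ContDiffOn ℝ (⊤ : ℕ∞) f (U ×ˢ univ)) (a b : ℝ) :
    ContDiffOn ℝ (⊤ : ℕ∞) (fun x ↦ ∫ t in a..b, f (x, t)) U := by
  have hderiv {G : Type u} [NormedAddCommGroup G] [NormedSpace ℝ G] {g : E × ℝ → G}
      (hg : ContDiffOn ℝ (⊤ : ℕ∞) g (U ×ˢ univ)) {x : E} (hx : x ∈ U) :=
    hasFDerivAt_intervalIntegral_of_contDiffOn hU (hg.of_le (mod_cast le_top)) hx a b
  refine contDiffOn_infty.mpr fun n ↦ ?_
  induction n generalizing F with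
  | zero => exact contDiffOn_zero.mpr fun x hx ↦ (hderiv hf hx).continuousAt.continuousWithinAt
  | succ n ih =>
    rw [Nat.cast_succ, contDiffOn_succ_iff_hasFDerivWithinAt_of_uniqueDiffOn hU.uniqueDiffOn]
    refine ⟨by simp, _, ?_, fun x hx ↦ (hderiv hf hx).hasFDerivWithinAt⟩
    exact ih ((hf.fderiv_of_isOpen (hU.prod isOpen_univ) (by simp)).clm_comp contDiffOn_const)

theorem fderiv_intervalIntegral_apply {E F : Type u} [NormedAddCommGroup E]
    [NormedSpace ℝ E] [FiniteDimensional ℝ E] [NormedAddCommGroup F] [NormedSpace ℝ F]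
    [CompleteSpace F] {U : Set E} (hU : IsOpen U) {f : E × ℝ → F}
    (hf : ContDiffOn ℝ 1 f (U ×ˢ univ)) {x : E} (hx : x ∈ U) (a b : ℝ) (v : E) :
    fderiv ℝ (fun x ↦ ∫ t in a..b, f (x, t)) x v =
      ∫ t in a..b, fderiv ℝ f (x, t) (v, 0) := by
  rw [(hasFDerivAt_intervalIntegral_of_contDiffOn hU hf hx a b).fderiv,
    ContinuousLinearMap.intervalIntegral_apply]
  · simp
  · have hc : Continuous fun t : ℝ ↦ fderiv ℝ f (x, t) :=
      (hf.continuousOn_fderiv_of_isOpen (hU.prod isOpen_univ) le_rfl).comp_continuous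
        (by fun_prop) fun t ↦ mk_mem_prod hx (mem_univ t)
    exact (hc.clm_comp continuous_const).intervalIntegrable _ _

/-- The derivative of a coordinate of a directional derivative. -/
theorem hasFDerivAt_fderiv_apply_apply {T : Type*} [NormedAddCommGroup T] [NormedSpace ℝ T]
    {H : T → Fin 2 → ℝ} {q : T} (hH : ContDiffAt ℝ (⊤ : ℕ∞) H q) (v : T) (i : Fin 2) :
    HasFDerivAt (fun r ↦ fderiv ℝ H r v i)
      ((ContinuousLinearMap.proj i).comp ((fderiv ℝ (fderiv ℝ H) q).flip v)) q := by
  have h : HasFDerivAt (fderiv ℝ H) (fderiv ℝ (fderiv ℝ H) q) q :=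
    ((hH.fderiv_right (m := 1) (WithTop.coe_le_coe.mpr le_top)).differentiableAt one_ne_zero).hasFDerivAt
  have h' : HasFDerivAt (fun r ↦ fderiv ℝ H r v) ((fderiv ℝ (fderiv ℝ H) q).flip v) q := by
    simpa using h.clm_apply (hasFDerivAt_const v q)
  exact hasFDerivAt_pi'.mp h' i

/-- The component along `u`, `v` of the pullback of the `2`-form `ρ dx ∧ dy` under `H`. -/
noncomputable def pullbackForm {T : Type*} [NormedAddCommGroup T] [NormedSpace ℝ T]
    (ρ : (Fin 2 → ℝ) → ℝ) (H : T → Fin 2 → ℝ) (u v q : T) : ℝ :=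
  ρ (H q) * (fderiv ℝ H q u 0 * fderiv ℝ H q v 1 - fderiv ℝ H q u 1 * fderiv ℝ H q v 0)

theorem contDiffOn_pullbackForm {T : Type*} [NormedAddCommGroup T] [NormedSpace ℝ T]
    {ρ : (Fin 2 → ℝ) → ℝ} {H : T → Fin 2 → ℝ} {U : Set (Fin 2 → ℝ)} {V : Set T}
    (hV : IsOpen V) (hρ : ContDiffOn ℝ (⊤ : ℕ∞) ρ U) (hH : ContDiffOn ℝ (⊤ : ℕ∞) H V)
    (hVU : MapsTo H V U) (u v : T) :
    ContDiffOn ℝ (⊤ : ℕ∞) (pullbackForm ρ H u v) V := by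
  have h (w : T) (i : Fin 2) : ContDiffOn ℝ (⊤ : ℕ∞) (fun q ↦ fderiv ℝ H q w i) V :=
    contDiffOn_pi.mp ((hH.fderiv_of_isOpen hV (by simp)).clm_apply contDiffOn_const) i
  exact (hρ.comp hH hVU).mul (((h u 0).mul (h v 1)).sub ((h u 1).mul (h v 0)))

theorem fderiv_pullbackForm {T : Type*} [NormedAddCommGroup T] [NormedSpace ℝ T]
    {ρ : (Fin 2 → ℝ) → ℝ} {H : T → Fin 2 → ℝ} {q : T}
    (hρ : DifferentiableAt ℝ ρ (H q)) (hH : ContDiffAt ℝ (⊤ : ℕ∞) H q) (u v w : T) :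
    fderiv ℝ (pullbackForm ρ H u v) q w =
      fderiv ℝ ρ (H q) (fderiv ℝ H q w) *
        (fderiv ℝ H q u 0 * fderiv ℝ H q v 1 - fderiv ℝ H q u 1 * fderiv ℝ H q v 0) +
      ρ (H q) *
        (fderiv ℝ (fderiv ℝ H) q w u 0 * fderiv ℝ H q v 1 +
          fderiv ℝ H q u 0 * fderiv ℝ (fderiv ℝ H) q w v 1 -
          fderiv ℝ (fderiv ℝ H) q w u 1 * fderiv ℝ H q v 0 -
          fderiv ℝ H q u 1 * fderiv ℝ (fderiv ℝ H) q w v 0) := by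
  have h1 : HasFDerivAt (fun r ↦ ρ (H r)) ((fderiv ℝ ρ (H q)).comp (fderiv ℝ H q)) q :=
    hρ.hasFDerivAt.comp q (hH.differentiableAt (by simp)).hasFDerivAt
  have h := hasFDerivAt_fderiv_apply_apply hH
  have h2 := h1.mul (((h u 0).mul (h v 1)).sub ((h u 1).mul (h v 0)))
  have h3 : HasFDerivAt (pullbackForm ρ H u v) _ q := h2
  rw [h3.fderiv]
  simp
  ring

/-- The pullback of a `2`-form on the plane is closed. -/
theorem fderiv_pullbackForm_cyclic {T : Type*} [NormedAddCommGroup T] [NormedSpace ℝ T]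
    {ρ : (Fin 2 → ℝ) → ℝ} {H : T → Fin 2 → ℝ} {q : T}
    (hρ : DifferentiableAt ℝ ρ (H q)) (hH : ContDiffAt ℝ (⊤ : ℕ∞) H q) (u v w : T) :
    fderiv ℝ (pullbackForm ρ H u v) q w + fderiv ℝ (pullbackForm ρ H v w) q u +
      fderiv ℝ (pullbackForm ρ H w u) q v = 0 := by
  have hs : IsSymmSndFDerivAt ℝ H q := hH.isSymmSndFDerivAt (by
    simpa using WithTop.coe_le_coe.mpr (le_top (a := (2 : ℕ∞))))
  have hlin (a : Fin 2 → ℝ) : fderiv ℝ ρ (H q) a =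
      a 0 * fderiv ℝ ρ (H q) ![1, 0] + a 1 * fderiv ℝ ρ (H q) ![0, 1] := by
    rw [← smul_eq_mul, ← smul_eq_mul, ← map_smul, ← map_smul, ← map_add]
    congr 1
    ext i
    fin_cases i <;> simp
  simp only [fderiv_pullbackForm hρ hH, hlin (fderiv ℝ H q _), hs.eq v u, hs.eq w u, hs.eq w v]
  ring

/-- Every smooth function on a contractible open subset of the plane is a divergence. -/
theorem exists_divergence_eq {U : Set (Fin 2 → ℝ)} (hU : IsOpen U) [ContractibleSpace U]
    {ρ : (Fin 2 → ℝ) → ℝ} (hρ : ContDiffOn ℝ (⊤ : ℕ∞) ρ U) :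
    ∃ a b : (Fin 2 → ℝ) → ℝ, ContDiffOn ℝ (⊤ : ℕ∞) a U ∧ ContDiffOn ℝ (⊤ : ℕ∞) b U ∧
      ∀ p ∈ U, fderiv ℝ a p ![1, 0] + fderiv ℝ b p ![0, 1] = ρ p := by
  obtain ⟨x₀, H, hH, hHU, hH0, hH1⟩ := exists_contDiffOn_contraction hU
  have hV : IsOpen (U ×ˢ (univ : Set ℝ)) := hU.prod isOpen_univ
  let T := (Fin 2 → ℝ) × ℝ
  let ex : T := (![1, 0], 0)
  let ey : T := (![0, 1], 0)
  let et : T := (0, 1)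
  have hform (u v : T) := contDiffOn_pullbackForm hV hρ hH hHU u v
  have hform1 (u v : T) : ContDiffOn ℝ 1 (pullbackForm ρ H u v) (U ×ˢ univ) :=
    (hform u v).of_le (mod_cast le_top)
  refine ⟨fun p ↦ ∫ t in (0 : ℝ)..1, pullbackForm ρ H ey et (p, t),
    fun p ↦ ∫ t in (0 : ℝ)..1, pullbackForm ρ H et ex (p, t),
    contDiffOn_intervalIntegral hU (hform _ _) _ _,
    contDiffOn_intervalIntegral hU (hform _ _) _ _, fun p hp ↦ ?_⟩
  have hmem (t : ℝ) : (p, t) ∈ U ×ˢ (univ : Set ℝ) := mk_mem_prod hp (mem_univ t)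
  have hHat (t : ℝ) : ContDiffAt ℝ (⊤ : ℕ∞) H (p, t) := hH.contDiffAt (hV.mem_nhds (hmem t))
  have hcont (u v w : T) : Continuous fun t : ℝ ↦ fderiv ℝ (pullbackForm ρ H u v) (p, t) w :=
    (((hform1 u v).continuousOn_fderiv_of_isOpen hV le_rfl).comp_continuous
        (by fun_prop) hmem).clm_apply continuous_const
  have hslice (t : ℝ) (v : Fin 2 → ℝ) :
      fderiv ℝ H (p, t) (v, 0) = fderiv ℝ (fun x ↦ H (x, t)) p v := by
    have hHt : HasFDerivAt H (fderiv ℝ H (p, t)) (p, t) :=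
      ((hHat t).differentiableAt (by simp)).hasFDerivAt
    have h : HasFDerivAt (fun x ↦ H (x, t)) _ p :=
      HasFDerivAt.comp (f := fun x ↦ (x, t)) p hHt (hasFDerivAt_prodMk_left p t)
    simp [h.fderiv]
  have hR0 : pullbackForm ρ H ex ey (p, 0) = ρ p := by
    have h (v : Fin 2 → ℝ) : fderiv ℝ H (p, 0) (v, 0) = v := by
      have he : (fun x ↦ H (x, 0)) =ᶠ[𝓝 p] id := by
        filter_upwards [hU.mem_nhds hp] with x hx using hH0 x hx
      rw [hslice, he.fderiv_eq, fderiv_id]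
      rfl
    simp [pullbackForm, ex, ey, h, hH0 p hp]
  have hR1 : pullbackForm ρ H ex ey (p, 1) = 0 := by
    have h (v : Fin 2 → ℝ) : fderiv ℝ H (p, 1) (v, 0) = 0 := by
      have he : (fun x ↦ H (x, 1)) =ᶠ[𝓝 p] fun _ ↦ x₀ := by
        filter_upwards [hU.mem_nhds hp] with x hx using hH1 x hx
      rw [hslice, he.fderiv_eq]
      simp
    simp [pullbackForm, ex, ey, h]
  have hftc : ∫ t in (0 : ℝ)..1, fderiv ℝ (pullbackForm ρ H ex ey) (p, t) et = - ρ p := by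
    rw [intervalIntegral.integral_eq_sub_of_hasDerivAt
      (f := fun t ↦ pullbackForm ρ H ex ey (p, t)) (fun t _ ↦ ?_)
      ((hcont _ _ _).intervalIntegrable _ _), hR0, hR1, zero_sub]
    have h := (((hform1 ex ey).differentiableOn one_ne_zero).differentiableAt
      (hV.mem_nhds (hmem t))).hasFDerivAt
    exact h.comp_hasDerivAt t ((hasDerivAt_const t p).prodMk (hasDerivAt_id t))
  rw [fderiv_intervalIntegral_apply hU (hform1 _ _) hp,
    fderiv_intervalIntegral_apply hU (hform1 _ _) hp, ← intervalIntegral.integral_add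
      ((hcont _ _ _).intervalIntegrable _ _) ((hcont _ _ _).intervalIntegrable _ _),
    ← neg_eq_iff_eq_neg.mpr hftc, ← intervalIntegral.integral_neg]
  refine intervalIntegral.integral_congr fun t _ ↦ ?_
  have h := fderiv_pullbackForm_cyclic
    ((hρ.differentiableOn (by simp)).differentiableAt (hU.mem_nhds (hHU (hmem t))))
    (hHat t) ex ey et
  simp only [ex, ey] at h ⊢
  linarith

theorem first_grushin_exact_final
    (U : Set (Fin 2 → ℝ)) (hU : IsOpen U) (hUc : ContractibleSpace U)
    (ρ : (Fin 2 → ℝ) → ℝ) (hρ : ContDiffOn ℝ (⊤ : ℕ∞) ρ U) :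
    ∃ c d : (Fin 2 → ℝ) → ℝ, ContDiffOn ℝ (⊤ : ℕ∞) c U ∧ ContDiffOn ℝ (⊤ : ℕ∞) d U ∧
      ∀ p ∈ U, opX d p + opY c p = ρ p := by
  obtain ⟨a, b, ha, hb, hab⟩ := exists_divergence_eq hU hρ
  have hb' (v : Fin 2 → ℝ) : ContDiffOn ℝ (⊤ : ℕ∞) (fun p ↦ fderiv ℝ b p v) U :=
    (hb.fderiv_of_isOpen hU (by simp)).clm_apply contDiffOn_const
  have hx : ContDiffOn ℝ (⊤ : ℕ∞) (fun p : Fin 2 → ℝ ↦ p 0) U := by fun_prop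
  refine ⟨fun p ↦ -fderiv ℝ b p ![1, 0], fun p ↦ a p + p 0 * fderiv ℝ b p ![0, 1],
    (hb' _).neg, ha.add (hx.mul (hb' _)), fun p hp ↦ ?_⟩
  have hs : IsSymmSndFDerivAt ℝ b p := (hb.contDiffAt (hU.mem_nhds hp)).isSymmSndFDerivAt (by
    simpa using WithTop.coe_le_coe.mpr (le_top (a := (2 : ℕ∞))))
  have hb2 : HasFDerivAt (fderiv ℝ b) (fderiv ℝ (fderiv ℝ b) p) p :=
    (((hb.fderiv_of_isOpen hU (m := 1) (WithTop.coe_le_coe.mpr le_top)).differentiableOn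
      one_ne_zero).differentiableAt (hU.mem_nhds hp)).hasFDerivAt
  have hbv (v : Fin 2 → ℝ) :
      HasFDerivAt (fun q ↦ fderiv ℝ b q v) ((fderiv ℝ (fderiv ℝ b) p).flip v) p := by
    simpa using hb2.clm_apply (hasFDerivAt_const v p)
  have hap := ((ha.differentiableOn (by simp)).differentiableAt (hU.mem_nhds hp)).hasFDerivAt
  have hd : HasFDerivAt (fun q ↦ a q + q 0 * fderiv ℝ b q ![0, 1]) _ p :=
    hap.add ((hasFDerivAt_apply (𝕜 := ℝ) (0 : Fin 2) p).mul (hbv _))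
  have hc : HasFDerivAt (fun q ↦ -fderiv ℝ b q ![1, 0]) _ p := (hbv _).neg
  have hy : (![0, p 0] : Fin 2 → ℝ) = p 0 • ![0, 1] := by simp
  rw [opX, opY, hd.fderiv, hc.fderiv, hy, map_smul, ← hab p hp]
  simp [hs.eq ![0, 1] ![1, 0]]
  ring
end
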